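/- Let c_n denote the number of closed Deutsch paths of length n. Then the sequence c_n · n^{3/2} · 3^{−n} converges to 9/(8·√(3π)) as n → ∞. -/

import Mathlib

open Filter Real

/-- A Deutsch path of length `n`: `a 0 = 0` and each step is either an up-step of one
unit or a down-step of arbitrary positive size. -/
def DeutschPath (n : ℕ) (a : Fin (n + 1) → ℕ) : Prop :=
  a 0 = 0 ∧ ∀ j : Fin n, a j.succ = a j.castSucc + 1 ∨ a j.succ < a j.castSucc

/-- The number of closed Deutsch paths of length `n`. -/
noncomputable def c (n : ℕ) : ℕ :=
  {a : Fin (n + 1) → ℕ | DeutschPath n a ∧ a (Fin.last n) = 0}.ncard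

/-- The walks with Deutsch steps of length `n` that start at height `k` and end at `0`. -/
noncomputable def deutschPathsFrom : (n : ℕ) → ℕ → Finset (Fin (n + 1) → ℕ)
  | 0, k => if k = 0 then {fun _ => 0} else ∅
  | n + 1, k => (insert (k + 1) (Finset.range k)).biUnion
      fun j => (deutschPathsFrom n j).image fun a => (Fin.cons k a : Fin (n + 2) → ℕ)

lemma mem_deutschPathsFrom {n k : ℕ} {a : Fin (n + 1) → ℕ} :
    a ∈ deutschPathsFrom n k ↔ a 0 = k ∧
      (∀ j : Fin n, a j.succ = a j.castSucc + 1 ∨ a j.succ < a j.castSucc) ∧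
      a (Fin.last n) = 0 := by
  induction n generalizing k with
  | zero =>
    by_cases hk : k = 0
    · subst hk
      simp [deutschPathsFrom, funext_iff, Fin.forall_fin_one]
    · simp only [deutschPathsFrom, hk, if_false, Finset.notMem_empty, false_iff]
      rintro ⟨h0, -, h1⟩
      exact hk (h0.symm.trans h1)
  | succ n ih =>
    induction a using Fin.consCases with
    | cons x a =>
    simp only [deutschPathsFrom, Finset.mem_biUnion, Finset.mem_image, ih, Fin.cons_inj,
      Finset.mem_insert, Finset.mem_range, Fin.forall_fin_succ (n := n), Fin.cons_zero,
      Fin.cons_succ, Fin.castSucc_zero, ← Fin.succ_castSucc, ← Fin.succ_last]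
    constructor
    · rintro ⟨j, hj, b, ⟨hb0, hb, hbl⟩, rfl, rfl⟩
      exact ⟨rfl, ⟨by rwa [hb0], hb⟩, hbl⟩
    · rintro ⟨rfl, ⟨h0, h⟩, hl⟩
      exact ⟨a 0, h0, a, ⟨rfl, h, hl⟩, rfl, rfl⟩

lemma c_eq_card (n : ℕ) : c n = (deutschPathsFrom n 0).card := by
  rw [c, ← Set.ncard_coe_finset]
  congr 1
  ext a
  simp [mem_deutschPathsFrom, DeutschPath, and_assoc]

lemma card_deutschPathsFrom_succ (n k : ℕ) :
    (deutschPathsFrom (n + 1) k).card =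
      (deutschPathsFrom n (k + 1)).card + ∑ j ∈ Finset.range k, (deutschPathsFrom n j).card := by
  rw [deutschPathsFrom, Finset.card_biUnion, Finset.sum_insert (by simp)]
  · simp [Finset.card_image_of_injective _ (Fin.cons_right_injective (α := fun _ => ℕ) k)]
  · intro i _ j _ hij
    rw [Function.onFun, Finset.disjoint_left]
    simp only [Finset.mem_image, mem_deutschPathsFrom]
    rintro _ ⟨a, ⟨ha, -⟩, rfl⟩ ⟨b, ⟨hb, -⟩, h⟩
    rw [Fin.cons_right_injective (α := fun _ => ℕ) k h] at hb
    exact hij (ha.symm.trans hb)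

/-- The eigenvectors, with eigenvalue `4 cos² φ - 1`, of the transfer operator of Deutsch paths,
weighted by the spectral density `sin² φ`. -/
noncomputable def deutschEigen : ℕ → ℝ → ℝ
  | 0, φ => sin φ ^ 2
  | k + 1, φ => (2 * cos φ) ^ k * sin ((k + 3) * φ) * sin φ

@[fun_prop]
lemma continuous_deutschEigen (k : ℕ) : Continuous (deutschEigen k) := by
  cases k <;> unfold deutschEigen <;> fun_prop

lemma deutschEigen_add_two (k : ℕ) (φ : ℝ) :
    deutschEigen (k + 2) φ =
      (2 * cos φ) ^ 2 * (deutschEigen (k + 1) φ - deutschEigen k φ) := by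
  cases k with
  | zero =>
    have h3 : ((1 : ℕ) + 3 : ℝ) * φ = 2 * (2 * φ) := by push_cast; ring
    simp only [deutschEigen, h3, sin_two_mul, cos_two_mul, zero_add, Nat.cast_zero, sin_three_mul]
    linear_combination (16 * sin φ ^ 2 * cos φ ^ 2) * sin_sq_add_cos_sq φ
  | succ k =>
    have h1 : ((k + 2 : ℕ) + 3 : ℝ) * φ = (k + 4) * φ + φ := by push_cast; ring
    have h2 : ((k : ℝ) + 3) * φ = (k + 4) * φ - φ := by ring
    have h3 : ((k + 1 : ℕ) + 3 : ℝ) * φ = (k + 4) * φ := by push_cast; ring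
    simp only [deutschEigen]
    rw [h1, h2, h3, sin_add, sin_sub]
    ring

lemma deutschEigen_succ_add_sum (k : ℕ) (φ : ℝ) :
    deutschEigen (k + 1) φ + ∑ j ∈ Finset.range k, deutschEigen j φ =
      (4 * cos φ ^ 2 - 1) * deutschEigen k φ := by
  induction k with
  | zero =>
    simp only [deutschEigen, zero_add, Nat.cast_zero, sin_three_mul, Finset.sum_range_zero]
    linear_combination (-4 * sin φ ^ 2) * sin_sq_add_cos_sq φ
  | succ k ih =>
    rw [Finset.sum_range_succ, deutschEigen_add_two]
    linear_combination ih

lemma integral_cos_pow_mul_cos_eq_zero (m j : ℕ) (h : m < j) :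
    ∫ φ in (0 : ℝ)..π, cos φ ^ m * cos (j * φ) = 0 := by
  induction m generalizing j with
  | zero =>
    have hj : (j : ℝ) ≠ 0 := by positivity
    simp [intervalIntegral.integral_comp_mul_left (fun x => cos x) hj]
  | succ m ih =>
    obtain ⟨j, rfl⟩ : ∃ i, j = i + 1 := ⟨j - 1, by omega⟩
    have key : ∀ φ : ℝ, cos φ ^ (m + 1) * cos ((j + 1 : ℕ) * φ) =
        (1 / 2) * (cos φ ^ m * cos ((j + 2 : ℕ) * φ)) + (1 / 2) * (cos φ ^ m * cos (j * φ)) := by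
      intro φ
      have h1 : ((j + 2 : ℕ) : ℝ) * φ = (j + 1 : ℕ) * φ + φ := by push_cast; ring
      have h2 : (j : ℝ) * φ = (j + 1 : ℕ) * φ - φ := by push_cast; ring
      rw [h1, h2, cos_add, cos_sub]
      ring
    simp_rw [key]
    rw [intervalIntegral.integral_add, intervalIntegral.integral_const_mul,
      intervalIntegral.integral_const_mul, ih _ (by omega), ih _ (by omega)]
    · simp
    all_goals exact Continuous.intervalIntegrable (by fun_prop) _ _

lemma integral_deutschEigen (k : ℕ) :
    ∫ φ in (0 : ℝ)..π, deutschEigen k φ = if k = 0 then π / 2 else 0 := by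
  cases k with
  | zero => simp [deutschEigen, integral_sin_sq]
  | succ k =>
    have key : ∀ φ : ℝ, deutschEigen (k + 1) φ =
        (2 ^ k / 2) * (cos φ ^ k * cos ((k + 2 : ℕ) * φ)) -
          (2 ^ k / 2) * (cos φ ^ k * cos ((k + 4 : ℕ) * φ)) := by
      intro φ
      have h1 : ((k + 4 : ℕ) : ℝ) * φ = (k + 3) * φ + φ := by push_cast; ring
      have h2 : ((k + 2 : ℕ) : ℝ) * φ = (k + 3) * φ - φ := by push_cast; ring
      rw [h1, h2, cos_add, cos_sub, deutschEigen]
      ring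
    simp_rw [key]
    rw [intervalIntegral.integral_sub, intervalIntegral.integral_const_mul,
      intervalIntegral.integral_const_mul, integral_cos_pow_mul_cos_eq_zero _ _ (by omega),
      integral_cos_pow_mul_cos_eq_zero _ _ (by omega)]
    · simp
    all_goals exact Continuous.intervalIntegrable (by fun_prop) _ _

lemma card_deutschPathsFrom_eq_integral (n k : ℕ) :
    ((deutschPathsFrom n k).card : ℝ) =
      2 / π * ∫ φ in (0 : ℝ)..π, (4 * cos φ ^ 2 - 1) ^ n * deutschEigen k φ := by
  induction n generalizing k with
  | zero =>
    simp only [pow_zero, one_mul, integral_deutschEigen, deutschPathsFrom]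
    split_ifs
    · simp [pi_ne_zero]
    · simp
  | succ n ih =>
    rw [card_deutschPathsFrom_succ]
    simp_rw [pow_succ _ n, mul_assoc, ← deutschEigen_succ_add_sum, mul_add,
      Finset.mul_sum]
    rw [intervalIntegral.integral_add, intervalIntegral.integral_finsetSum]
    · simp [ih, mul_add, Finset.mul_sum]
    all_goals try intros
    all_goals exact Continuous.intervalIntegrable (by fun_prop) _ _

lemma c_eq_integral (n : ℕ) :
    (c n : ℝ) = 4 / π * ∫ φ in (0 : ℝ)..π / 2, (4 * cos φ ^ 2 - 1) ^ n * sin φ ^ 2 := by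
  set f : ℝ → ℝ := fun φ => (4 * cos φ ^ 2 - 1) ^ n * sin φ ^ 2 with hf
  have hfi (a b : ℝ) : IntervalIntegrable f MeasureTheory.volume a b :=
    Continuous.intervalIntegrable (by fun_prop) _ _
  have hsymm : ∫ φ in π / 2..π, f φ = ∫ φ in (0 : ℝ)..π / 2, f φ := by
    have h := intervalIntegral.integral_comp_sub_left f π (a := 0) (b := π / 2)
    rw [sub_zero, sub_half] at h
    rw [← h]
    simp [hf]
  rw [c_eq_card, card_deutschPathsFrom_eq_integral]
  change 2 / π * ∫ φ in (0 : ℝ)..π, f φ = _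
  rw [← intervalIntegral.integral_add_adjacent_intervals (hfi 0 (π / 2)) (hfi (π / 2) π), hsymm]
  ring

lemma integral_sq_mul_exp_neg_mul_sq {b : ℝ} (hb : 0 < b) :
    ∫ t in Set.Ioi (0 : ℝ), t ^ 2 * exp (-b * t ^ 2) = √π / (4 * (b * √b)) := by
  have h := integral_rpow_mul_exp_neg_mul_rpow (p := 2) (q := 2) two_pos (by norm_num) hb
  have hG : Gamma ((2 + 1) / 2) = √π / 2 := by
    rw [show ((2 + 1) / 2 : ℝ) = 1 / 2 + 1 by norm_num, Gamma_add_one (by norm_num),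
      Gamma_one_half_eq]
    ring
  have hb' : b ^ (-(2 + 1) / 2 : ℝ) = (b * √b)⁻¹ := by
    rw [show (-(2 + 1) / 2 : ℝ) = -(1 + 1 / 2) by norm_num, rpow_neg hb.le, rpow_add hb, rpow_one,
      sqrt_eq_rpow]
  simp only [rpow_two] at h
  rw [h, hG, hb', mul_inv]
  field_simp
  ring

lemma four_mul_cos_sq_sub_one (φ : ℝ) : 4 * cos φ ^ 2 - 1 = 3 * (1 - 4 / 3 * sin φ ^ 2) := by
  linear_combination (4 : ℝ) * sin_sq_add_cos_sq φ

lemma abs_one_sub_mul_sin_sq_pow_le (n : ℕ) {φ : ℝ} (h0 : 0 ≤ φ) (h1 : φ ≤ π / 2) :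
    |1 - 4 / 3 * sin φ ^ 2| ^ n ≤ exp (-(8 / (3 * π ^ 2)) * (n * φ ^ 2)) := by
  have hs : (2 / π * φ) ^ 2 ≤ sin φ ^ 2 := by
    have := mul_le_sin h0 h1
    gcongr
  have hs1 := sin_sq_le_one φ
  have hle : |1 - 4 / 3 * sin φ ^ 2| ≤ exp (-(2 / 3 * (2 / π * φ) ^ 2)) := by
    have := add_one_le_exp (-(2 / 3 * (2 / π * φ) ^ 2))
    rw [abs_le]
    constructor <;> linarith [sq_nonneg (sin φ)]
  calc _ ≤ exp (-(2 / 3 * (2 / π * φ) ^ 2)) ^ n := by gcongr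
    _ = _ := by
      rw [← exp_nat_mul]
      congr 1
      field_simp
      ring

/-- The integrand representing `c n` after rescaling the angle by `√n`. -/
noncomputable def rescaledIntegrand (n : ℕ) : ℝ → ℝ :=
  (Set.Ioc 0 (π / 2 * √n)).indicator
    fun t => (1 - 4 / 3 * sin (t / √n) ^ 2) ^ n * (n * sin (t / √n) ^ 2)

lemma rescaled_c_eq_integral {n : ℕ} (hn : n ≠ 0) :
    (c n : ℝ) * (n : ℝ) ^ ((3 : ℝ) / 2) / 3 ^ n =
      4 / π * ∫ t in Set.Ioi (0 : ℝ), rescaledIntegrand n t := by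
  have hs : √(n : ℝ) ≠ 0 := by positivity
  have h0 : (0 : ℝ) ≤ π / 2 * √n := by positivity
  have hpow : (n : ℝ) ^ ((3 : ℝ) / 2) = n * √n := by
    rw [show (3 / 2 : ℝ) = 1 + 1 / 2 by norm_num, rpow_add (by positivity), rpow_one, sqrt_eq_rpow]
  have h := intervalIntegral.integral_comp_div (a := 0) (b := π / 2 * √n)
    (fun φ => (1 - 4 / 3 * sin φ ^ 2) ^ n * (n * sin φ ^ 2)) hs
  rw [zero_div, mul_div_cancel_right₀ _ hs, smul_eq_mul] at h
  rw [rescaledIntegrand, MeasureTheory.setIntegral_indicator measurableSet_Ioc,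
    Set.inter_eq_right.2 Set.Ioc_subset_Ioi_self, ← intervalIntegral.integral_of_le h0, h,
    c_eq_integral, hpow]
  simp_rw [four_mul_cos_sq_sub_one, mul_pow, mul_assoc, mul_left_comm _ (n : ℝ)]
  rw [intervalIntegral.integral_const_mul, intervalIntegral.integral_const_mul]
  field_simp

lemma norm_rescaledIntegrand_le (n : ℕ) {t : ℝ} (ht : 0 < t) :
    ‖rescaledIntegrand n t‖ ≤ t ^ 2 * exp (-(8 / (3 * π ^ 2)) * t ^ 2) := by
  rw [rescaledIntegrand, norm_indicator_eq_indicator_norm]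
  refine Set.indicator_apply_le' (fun h => ?_) (fun _ => by positivity)
  have hn : 0 < √(n : ℝ) := by
    by_contra! hn
    have := mul_nonpos_of_nonneg_of_nonpos (a := π / 2) (by positivity) hn
    linarith [h.1, h.2]
  have hsq : n * (t / √n) ^ 2 = t ^ 2 := by
    rw [div_pow, sq_sqrt (Nat.cast_nonneg n)]
    rw [sqrt_pos] at hn
    field_simp
  have h1 := abs_one_sub_mul_sin_sq_pow_le n (φ := t / √n) (by positivity) ((div_le_iff₀ hn).2 h.2)
  have h2 : n * sin (t / √n) ^ 2 ≤ t ^ 2 := by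
    rw [← hsq]
    exact mul_le_mul_of_nonneg_left (sq_le_sq.2 abs_sin_le_abs) (Nat.cast_nonneg n)
  rw [hsq] at h1
  rw [norm_mul, norm_pow, norm_eq_abs, norm_of_nonneg (by positivity), mul_comm (t ^ 2)]
  gcongr

lemma tendsto_nat_mul_sin_div_sqrt_sq (t : ℝ) :
    Tendsto (fun n : ℕ => n * sin (t / √n) ^ 2) atTop (nhds (t ^ 2)) := by
  have hs : Tendsto (fun n : ℕ => √(n : ℝ)) atTop atTop :=
    tendsto_sqrt_atTop.comp tendsto_natCast_atTop_atTop
  have hd : Tendsto (fun n : ℕ => t / √n) atTop (nhds 0) := hs.const_div_atTop t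
  have hc : Tendsto (fun n : ℕ => (t * sinc (t / √n)) ^ 2) atTop (nhds (t ^ 2)) := by
    simpa using (((continuous_sinc.tendsto 0).comp hd).const_mul t).pow 2
  refine hc.congr' ?_
  filter_upwards [eventually_ne_atTop 0] with n hn
  have hn' : √(n : ℝ) ≠ 0 := by positivity
  rcases eq_or_ne t 0 with rfl | ht
  · simp
  · rw [sinc_of_ne_zero (by positivity)]
    field_simp
    rw [sq_sqrt (Nat.cast_nonneg n), mul_comm]

lemma tendsto_rescaledIntegrand {t : ℝ} (ht : 0 < t) :
    Tendsto (fun n => rescaledIntegrand n t) atTop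
      (nhds (t ^ 2 * exp (-(4 / 3) * t ^ 2))) := by
  have hs : Tendsto (fun n : ℕ => π / 2 * √(n : ℝ)) atTop atTop :=
    (tendsto_sqrt_atTop.comp tendsto_natCast_atTop_atTop).const_mul_atTop (by positivity)
  have h1 := tendsto_nat_mul_sin_div_sqrt_sq t
  have h2 : Tendsto (fun n : ℕ => (1 + -(4 / 3) * sin (t / √n) ^ 2) ^ n) atTop
      (nhds (exp (-(4 / 3) * t ^ 2))) :=
    tendsto_one_add_pow_exp_of_tendsto <|
      (h1.const_mul (-(4 / 3))).congr fun n => by ring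
  rw [mul_comm]
  refine (h2.mul h1).congr' ?_
  filter_upwards [hs.eventually_ge_atTop t] with n hn
  rw [rescaledIntegrand, Set.indicator_of_mem (Set.mem_Ioc.2 ⟨ht, hn⟩)]
  ring

lemma tendsto_integral_rescaledIntegrand :
    Tendsto (fun n => ∫ t in Set.Ioi (0 : ℝ), rescaledIntegrand n t) atTop
      (nhds (∫ t in Set.Ioi (0 : ℝ), t ^ 2 * exp (-(4 / 3) * t ^ 2))) := by
  refine MeasureTheory.tendsto_integral_of_dominated_convergence
    (fun t => t ^ 2 * exp (-(8 / (3 * π ^ 2)) * t ^ 2)) (fun n => ?_) ?_ (fun n => ?_) ?_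
  · refine (Measurable.indicator ?_ measurableSet_Ioc).aestronglyMeasurable
    fun_prop
  · have hb : 0 < 8 / (3 * π ^ 2) := by positivity
    simpa [MeasureTheory.IntegrableOn] using integrableOn_rpow_mul_exp_neg_mul_sq hb (s := 2) (by norm_num)
  · filter_upwards [MeasureTheory.ae_restrict_mem measurableSet_Ioi] with t ht
    exact norm_rescaledIntegrand_le n ht
  · filter_upwards [MeasureTheory.ae_restrict_mem measurableSet_Ioi] with t ht
    exact tendsto_rescaledIntegrand ht

theorem closed_deutsch_asymptotics :
    Tendsto (fun n : ℕ => (c n : ℝ) * (n : ℝ) ^ ((3 : ℝ) / 2) / 3 ^ n) atTop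
      (nhds (9 / (8 * Real.sqrt (3 * Real.pi)))) := by
  have h := tendsto_integral_rescaledIntegrand.const_mul (4 / π)
  rw [integral_sq_mul_exp_neg_mul_sq (by norm_num)] at h
  have hval : 4 / π * (√π / (4 * (4 / 3 * √(4 / 3)))) = 9 / (8 * √(3 * π)) := by
    have h4 : √(4 / 3 : ℝ) = 2 / √3 := by
      rw [sqrt_div (by norm_num), show (4 : ℝ) = 2 ^ 2 by norm_num, sqrt_sq (by norm_num)]
    have hp := sq_sqrt pi_pos.le
    have h3 := sq_sqrt (show (0 : ℝ) ≤ 3 by norm_num)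
    rw [h4, sqrt_mul (by norm_num)]
    field_simp
    rw [hp, h3]
    ring
  rw [hval] at h
  refine h.congr' ?_
  filter_upwards [eventually_ne_atTop 0] with n hn
  exact (rescaled_c_eq_integral hn).symm
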